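/- Let s be the multiplicative arithmetic function determined by s(1) = 1, s(p) = 1 − 3/p², s(p²) = 1 − 3/p² + 3/p⁴, and s(p^α) = (1 − 1/p²)³ for every prime p and every integer α ≥ 3. Then, as X → ∞, Σ_{k ≥ 2} Σ_{1 ≤ N ≤ X/k²} (k−1) N² s(N) = C·X³ + O(X²), where C = (1/(3 ζ(3)³)) · Σ_{k ≥ 2} (k−1) k^{-6} and ζ is the Riemann zeta function. -/

import Mathlib

open Filter ArithmeticFunction

theorem abs_sum_sub_tsum_le {ι : Type*} {F : Finset ι} {u v w : ι → ℝ}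
    (hu : ∀ i ∉ F, u i = 0) (hv : Summable v) (hw : Summable w)
    (huv : ∀ i, |u i - v i| ≤ w i) : |∑ i ∈ F, u i - ∑' i, v i| ≤ ∑' i, w i := by
  have hsum : HasSum (fun i => u i - v i) (∑ i ∈ F, u i - ∑' i, v i) :=
    (hasSum_sum_of_ne_finset_zero hu).sub hv.hasSum
  rw [← hsum.tsum_eq, ← Real.norm_eq_abs]
  exact tsum_of_norm_bounded hw.hasSum huv

theorem sum_Ioc_sq (n : ℕ) :
    ∑ m ∈ Finset.Ioc 0 n, (m : ℝ) ^ 2 = n * (n + 1) * (2 * n + 1) / 6 := by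
  induction n with
  | zero => simp
  | succ n ih =>
    rw [Finset.sum_Ioc_succ_top n.zero_le, ih]
    push_cast
    ring

theorem abs_sum_Ioc_floor_sq_sub_le {y : ℝ} (hy : 0 ≤ y) :
    |∑ m ∈ Finset.Ioc 0 ⌊y⌋₊, (m : ℝ) ^ 2 - y ^ 3 / 3| ≤ y ^ 2 := by
  rw [sum_Ioc_sq]
  have h1 := Nat.floor_le hy
  have h2 := Nat.lt_floor_add_one y
  have h3 : (⌊y⌋₊ : ℝ) ≤ (⌊y⌋₊ : ℝ) ^ 2 := by
    exact_mod_cast Nat.le_self_pow two_ne_zero _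
  have h0 : (0 : ℝ) ≤ ⌊y⌋₊ := Nat.cast_nonneg _
  generalize (⌊y⌋₊ : ℝ) = n at *
  have h4 : n ^ 2 ≤ y ^ 2 := by gcongr
  have h5 : n ^ 3 ≤ y ^ 3 := by gcongr
  have h6 : y ^ 3 - n ^ 3 ≤ 3 * y ^ 2 := by
    have : y ^ 3 - n ^ 3 = (y - n) * (y ^ 2 + y * n + n ^ 2) := by ring
    rw [this]
    have h7 : y * n ≤ y ^ 2 := by nlinarith
    calc (y - n) * (y ^ 2 + y * n + n ^ 2) ≤ 1 * (y ^ 2 + y * n + n ^ 2) := by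
          gcongr
          linarith
      _ ≤ 3 * y ^ 2 := by linarith
  rw [abs_le]
  constructor <;> nlinarith

/-- If `h` has an absolutely convergent Dirichlet series at `2`, then the summatory function of
the Dirichlet convolution of `h` with `n ↦ n²` is `Y³/3 · ∑ h(d)/d³ + O(Y²)`, uniformly in
`Y ≥ 0`. -/
theorem abs_sum_mul_sq_sub_le {h q : ArithmeticFunction ℝ} (hq : ∀ n, q n = (n : ℝ) ^ 2)
    (h2 : Summable fun d => |h d| / (d : ℝ) ^ 2) (h3 : Summable fun d => h d / (d : ℝ) ^ 3)
    {Y : ℝ} (hY : 0 ≤ Y) :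
    |∑ n ∈ Finset.Ioc 0 ⌊Y⌋₊, (h * q) n - (∑' d, h d / (d : ℝ) ^ 3) * (Y ^ 3 / 3)| ≤
      (∑' d, |h d| / (d : ℝ) ^ 2) * Y ^ 2 := by
  rw [sum_Ioc_mul_eq_sum_sum, ← tsum_mul_right, ← tsum_mul_right]
  refine abs_sum_sub_tsum_le (fun d hd => ?_) (h3.mul_right _) (h2.mul_right _) fun d => ?_
  · rcases d.eq_zero_or_pos with rfl | hd0
    · simp
    · have : ⌊Y⌋₊ < d := by
        by_contra! hle
        exact hd (Finset.mem_Ioc.mpr ⟨hd0, hle⟩)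
      simp [Nat.div_eq_of_lt this]
  · simp_rw [hq, ← Nat.floor_div_natCast]
    have key := mul_le_mul_of_nonneg_left
      (abs_sum_Ioc_floor_sq_sub_le (y := Y / d) (by positivity)) (abs_nonneg (h d))
    rw [← abs_mul, mul_sub] at key
    refine (le_of_eq ?_).trans (key.trans (le_of_eq ?_))
    · congr 2
      ring
    · ring

theorem moebius_mul_apply_prime_pow_succ (F : ArithmeticFunction ℝ) {p : ℕ} (hp : p.Prime)
    (a : ℕ) : ((moebius : ArithmeticFunction ℝ) * F) (p ^ (a + 1)) = F (p ^ (a + 1)) - F (p ^ a) := by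
  have key (b : ℕ) : F (p ^ b) =
      ∑ i ∈ Finset.range (b + 1), ((moebius : ArithmeticFunction ℝ) * F) (p ^ i) := by
    rw [← Nat.sum_divisors_prime_pow hp, ← coe_zeta_mul_apply, ← mul_assoc,
      coe_zeta_mul_coe_moebius, one_mul]
  rw [key (a + 1), Finset.sum_range_succ, ← key a]
  ring

theorem moebius_mul_apply_one (F : ArithmeticFunction ℝ) :
    ((moebius : ArithmeticFunction ℝ) * F) 1 = F 1 := by
  simp

/-- The values of `s` on prime powers say that `n² s(n)` is the Dirichlet convolution of
`μ * μ * μ` with `n²`. -/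
theorem pmul_sq_eq_moebius_mul (s q : ArithmeticFunction ℝ) (hmul : s.IsMultiplicative)
    (hp1 : ∀ p : ℕ, p.Prime → s p = 1 - 3 / (p : ℝ) ^ 2)
    (hp2 : ∀ p : ℕ, p.Prime → s (p ^ 2) = 1 - 3 / (p : ℝ) ^ 2 + 3 / (p : ℝ) ^ 4)
    (hp3 : ∀ p α : ℕ, p.Prime → 3 ≤ α → s (p ^ α) = (1 - 1 / (p : ℝ) ^ 2) ^ 3)
    (hq : ∀ n, q n = (n : ℝ) ^ 2) :
    q.pmul s = (moebius : ArithmeticFunction ℝ) * (moebius * (moebius * q)) := by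
  have hqm : q.IsMultiplicative := ⟨by simp [hq], fun _ => by simp [hq, mul_pow]⟩
  have hM : (moebius : ArithmeticFunction ℝ).IsMultiplicative := isMultiplicative_moebius.intCast
  rw [(hqm.pmul hmul).eq_iff_eq_on_prime_powers _ _ (hM.mul (hM.mul (hM.mul hqm)))]
  intro p i hp
  have hp0 : (p : ℝ) ≠ 0 := by exact_mod_cast hp.ne_zero
  rw [pmul_apply]
  match i with
  | 0 => simp [hmul.map_one]
  | 1 =>
    have := moebius_mul_apply_prime_pow_succ (moebius * (moebius * q)) hp 0
    have h1 := moebius_mul_apply_prime_pow_succ (moebius * q) hp 0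
    have h2 := moebius_mul_apply_prime_pow_succ q hp 0
    simp only [pow_zero, moebius_mul_apply_one, zero_add] at this h1 h2
    rw [this, h1, h2, pow_one, hp1 p hp]
    simp only [hq]
    push_cast
    field_simp
    ring
  | 2 =>
    simp only [moebius_mul_apply_prime_pow_succ _ hp, pow_zero, moebius_mul_apply_one, hq,
      show p ^ 2 = p ^ (1 + 1) from rfl, show p ^ 1 = p ^ (0 + 1) from rfl]
    rw [show p ^ (1 + 1) = p ^ 2 from rfl, hp2 p hp]
    push_cast
    field_simp
    ring
  | a + 3 =>
    simp only [moebius_mul_apply_prime_pow_succ _ hp, hq, hp3 p (a + 3) hp (by lia)]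
    push_cast
    field_simp
    ring

theorem LSeriesHasSum_moebius_cube {z : ℂ} (hz : 1 < z.re) :
    LSeriesHasSum (fun n => ((moebius * (moebius * moebius) : ArithmeticFunction ℤ) n : ℂ)) z
      ((riemannZeta z)⁻¹ ^ 3) := by
  have hM : LSeriesHasSum (fun n => (moebius : ArithmeticFunction ℂ) n) z (riemannZeta z)⁻¹ := by
    have hs : LSeriesSummable (fun n => ((moebius n : ℤ) : ℂ)) z := LSeriesSummable_moebius_iff.mpr hz
    have hval := LSeries_zeta_mul_Lseries_moebius hz
    rw [LSeries_zeta_eq_riemannZeta hz] at hval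
    rw [inv_eq_of_mul_eq_one_right hval]
    exact hs.LSeriesHasSum
  have h := LSeriesHasSum_mul hM (LSeriesHasSum_mul hM hM)
  rw [← intCoe_mul, ← intCoe_mul] at h
  rwa [pow_succ', pow_two]

theorem summable_abs_moebius_cube_div_sq :
    Summable fun d : ℕ =>
      |((moebius * (moebius * moebius) : ArithmeticFunction ℤ) d : ℝ)| / (d : ℝ) ^ 2 := by
  have h := (LSeriesHasSum_moebius_cube (z := 2) (by norm_num)).LSeriesSummable.norm
  refine h.congr fun n => ?_
  rcases eq_or_ne n 0 with rfl | hn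
  · simp
  · rw [LSeries.term_of_ne_zero hn, norm_div]
    rw [Complex.norm_intCast, Complex.cpow_ofNat, norm_pow, Complex.norm_natCast]

theorem hasSum_moebius_cube_div_cube :
    HasSum (fun d : ℕ =>
      ((moebius * (moebius * moebius) : ArithmeticFunction ℤ) d : ℝ) / (d : ℝ) ^ 3)
      ((∑' n : ℕ, ((n : ℝ) ^ 3)⁻¹)⁻¹ ^ 3) := by
  have h := LSeriesHasSum_moebius_cube (z := (3 : ℕ)) (by norm_num)
  rw [zeta_nat_eq_tsum_of_gt_one (by norm_num), LSeriesHasSum] at h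
  rw [← Complex.hasSum_ofReal]
  convert h using 1
  · ext n
    rcases eq_or_ne n 0 with rfl | hn
    · simp
    · rw [LSeries.term_of_ne_zero hn, Complex.cpow_natCast]
      push_cast
      rfl
  · push_cast
    simp

theorem summable_add_one_div_add_two_pow {n : ℕ} (hn : 3 ≤ n) :
    Summable fun j : ℕ => ((j : ℝ) + 1) / ((j : ℝ) + 2) ^ n := by
  have hs := (summable_nat_add_iff 2).mpr (Real.summable_nat_pow_inv.mpr one_lt_two)
  refine hs.of_nonneg_of_le (fun j => by positivity) fun j => ?_
  have hj : (0 : ℝ) ≤ j := j.cast_nonneg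
  push_cast
  rw [div_le_iff₀ (by positivity)]
  calc (j : ℝ) + 1 ≤ (j : ℝ) + 2 := by linarith
    _ = (((j : ℝ) + 2) ^ 2)⁻¹ * ((j : ℝ) + 2) ^ 3 := by field_simp
    _ ≤ (((j : ℝ) + 2) ^ 2)⁻¹ * ((j : ℝ) + 2) ^ n := by
      gcongr
      linarith

/-- For the multiplicative arithmetic function `s` with `s(p) = 1 - 3/p²`,
`s(p²) = 1 - 3/p² + 3/p⁴` and `s(p^α) = (1 - 1/p²)³` for `α ≥ 3`, one has
`Σ_{k ≥ 2} Σ_{N ≤ X/k²} (k-1) N² s(N) = C X³ + O(X²)` where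
`C = (1/(3ζ(3)³)) Σ_{k ≥ 2} (k-1) k⁻⁶`.  (The sum over `k ≥ 2` is written below as
`Σ_{k≥2} (k-1) k⁻⁶ = Σ_{j≥0} (j+1)/(j+2)⁶` via `k = j + 2`; the inner range
`1 ≤ N ≤ ⌊X/k²⌋` is empty as soon as `k² > X`.) -/
theorem newform_dimension_sum_asymptotic
    (s : ArithmeticFunction ℝ) (hmul : s.IsMultiplicative)
    (hp1 : ∀ p : ℕ, p.Prime → s p = 1 - 3 / (p : ℝ) ^ 2)
    (hp2 : ∀ p : ℕ, p.Prime → s (p ^ 2) = 1 - 3 / (p : ℝ) ^ 2 + 3 / (p : ℝ) ^ 4)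
    (hp3 : ∀ p α : ℕ, p.Prime → 3 ≤ α → s (p ^ α) = (1 - 1 / (p : ℝ) ^ 2) ^ 3) :
    (fun X : ℝ =>
        (∑ k ∈ Finset.Icc 2 ⌊X⌋₊, ∑ N ∈ Finset.Icc 1 ⌊X / (k : ℝ) ^ 2⌋₊,
          ((k : ℝ) - 1) * (N : ℝ) ^ 2 * s N) -
        (1 / (3 * (∑' n : ℕ, ((n : ℝ) ^ 3)⁻¹) ^ 3) *
          ∑' j : ℕ, ((j : ℝ) + 1) / ((j : ℝ) + 2) ^ 6) * X ^ 3)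
      =O[atTop] fun X : ℝ => X ^ 2 := by
  set h : ArithmeticFunction ℝ :=
    ((moebius * (moebius * moebius) : ArithmeticFunction ℤ) : ArithmeticFunction ℝ) with hh
  set q : ArithmeticFunction ℝ := ⟨fun n => (n : ℝ) ^ 2, by simp⟩
  have hq (n : ℕ) : q n = (n : ℝ) ^ 2 := rfl
  have hconv : q.pmul s = h * q := by
    rw [pmul_sq_eq_moebius_mul s q hmul hp1 hp2 hp3 hq, hh, intCoe_mul, intCoe_mul, mul_assoc,
      mul_assoc]
  have h2 : Summable fun d => |h d| / (d : ℝ) ^ 2 := summable_abs_moebius_cube_div_sq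
  have h3 : HasSum (fun d => h d / (d : ℝ) ^ 3) _ := hasSum_moebius_cube_div_cube
  set Z := ∑' n : ℕ, ((n : ℝ) ^ 3)⁻¹
  set K := ∑' d, |h d| / (d : ℝ) ^ 2
  have bound {Y : ℝ} (hY : 0 ≤ Y) := abs_sum_mul_sq_sub_le hq h2 h3.summable hY
  rw [h3.tsum_eq] at bound
  have hS6 : Summable fun j : ℕ => ((j : ℝ) + 1) / ((j : ℝ) + 2) ^ 6 :=
    summable_add_one_div_add_two_pow (by norm_num)
  have hS4 : Summable fun j : ℕ => ((j : ℝ) + 1) / ((j : ℝ) + 2) ^ 4 :=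
    summable_add_one_div_add_two_pow (by norm_num)
  refine Asymptotics.IsBigO.of_bound (∑' j : ℕ, ((j : ℝ) + 1) / ((j : ℝ) + 2) ^ 4 * K) ?_
  filter_upwards [eventually_ge_atTop 0] with X hX
  rw [Real.norm_eq_abs, Real.norm_of_nonneg (sq_nonneg X), mul_assoc, ← tsum_mul_right,
    ← tsum_mul_left, ← tsum_mul_right]
  have reindex : Finset.Icc 2 ⌊X⌋₊ = (Finset.range (⌊X⌋₊ - 1)).map (addRightEmbedding 2) := by
    ext k
    simp only [Finset.mem_Icc, Finset.mem_map, Finset.mem_range, addRightEmbedding_apply]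
    constructor
    · exact fun hk => ⟨k - 2, by lia, by lia⟩
    · rintro ⟨j, hj, rfl⟩
      lia
  rw [reindex, Finset.sum_map]
  have inner (j : ℕ) : ∑ N ∈ Finset.Icc 1 ⌊X / ((addRightEmbedding 2 j : ℕ) : ℝ) ^ 2⌋₊,
      (((addRightEmbedding 2 j : ℕ) : ℝ) - 1) * (N : ℝ) ^ 2 * s N =
      ((j : ℝ) + 1) * ∑ n ∈ Finset.Ioc 0 ⌊X / ((j : ℝ) + 2) ^ 2⌋₊, (h * q) n := by
    rw [← hconv, Finset.mul_sum]
    simp only [addRightEmbedding_apply, Nat.cast_add, Nat.cast_ofNat, pmul_apply, hq]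
    refine Finset.sum_congr rfl fun n _ => ?_
    ring
  simp_rw [inner]
  refine abs_sum_sub_tsum_le (fun j hj => ?_) ((hS6.mul_right _).mul_left _)
    ((hS4.mul_right _).mul_right _) fun j => ?_
  · have hlt : X < (j : ℝ) + 2 := by
      have : ⌊X⌋₊ < j + 2 := by
        simp only [Finset.mem_range] at hj
        lia
      exact_mod_cast (Nat.floor_lt hX).mp this
    have : ⌊X / ((j : ℝ) + 2) ^ 2⌋₊ = 0 := by
      rw [Nat.floor_eq_zero, div_lt_one (by positivity)]
      nlinarith [(j.cast_nonneg : (0 : ℝ) ≤ j)]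
    simp [this]
  · have key := mul_le_mul_of_nonneg_left (bound (Y := X / ((j : ℝ) + 2) ^ 2) (by positivity))
      (by positivity : (0 : ℝ) ≤ (j : ℝ) + 1)
    rw [← abs_of_nonneg (by positivity : (0 : ℝ) ≤ (j : ℝ) + 1), ← abs_mul, mul_sub,
      abs_of_nonneg (by positivity : (0 : ℝ) ≤ (j : ℝ) + 1)] at key
    refine (le_of_eq ?_).trans (key.trans (le_of_eq ?_))
    · congr 2
      field_simp
    · rw [show ∑' d, |h d| / (d : ℝ) ^ 2 = K from rfl]
      field_simp
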